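/- Geodesic property of the SCDT on positive measures: let ν₁, ν₂ be nonzero finite (positive) measures on a compact interval I ⊂ ℝ, with total masses mᵢ := νᵢ(ℝ), normalizations νᵢᴺ := νᵢ/mᵢ, and quantile functions qᵢ := F_{νᵢᴺ}†. For t ∈ [0,1] define ρ_t := ((1−t)m₁ + t m₂) · (((1−t)q₁ + t q₂)_# 𝕌). Define the SCDT distance on nonzero finite positive measures by d(σ₁,σ₂)² := ‖F_{σ₁ᴺ}† − F_{σ₂ᴺ}†‖²_{L²(𝕌)} + (σ₁(ℝ) − σ₂(ℝ))². Then ρ₀ = ν₁, ρ₁ = ν₂, the total mass satisfies ρ_t(ℝ) = (1−t)m₁ + t m₂, and for all s, t ∈ [0,1], d(ρ_t, ρ_s) = |t − s| · d(ν₁, ν₂). -/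

import Mathlib

open MeasureTheory Set

/-- The cumulative distribution function (CDF) of a measure `ν` on `ℝ`. -/
noncomputable def Fcdf (ν : Measure ℝ) (x : ℝ) : ℝ := (ν (Iic x)).toReal

/-- The generalized inverse (quantile function) of the CDF of `ν`. -/
noncomputable def Fq (ν : Measure ℝ) (y : ℝ) : ℝ := sInf {x : ℝ | Fcdf ν x > y}

/-- The Lebesgue measure restricted to `[0,1]` (the uniform measure on `[0,1]`). -/
noncomputable def unif : Measure ℝ := volume.restrict (Icc (0:ℝ) 1)

/-- Total mass of a measure on `ℝ`, as a real number. -/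
noncomputable def mass (σ : Measure ℝ) : ℝ := (σ univ).toReal

/-- Normalization `σᴺ := σ / σ(ℝ)` of a measure. -/
noncomputable def nrml (σ : Measure ℝ) : Measure ℝ := (σ univ)⁻¹ • σ

/-- SCDT distance on nonzero finite positive measures:
`d(σ₁,σ₂)² = ‖F_{σ₁ᴺ}† − F_{σ₂ᴺ}†‖²_{L²(𝕌)} + (σ₁(ℝ) − σ₂(ℝ))²`. -/
noncomputable def dSCDT (σ₁ σ₂ : Measure ℝ) : ℝ :=
  Real.sqrt ((∫ y, |Fq (nrml σ₁) y - Fq (nrml σ₂) y| ^ 2 ∂unif)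
    + (mass σ₁ - mass σ₂) ^ 2)

/-- SCDT interpolation on positive measures:
`ρ_t := ((1−t)m₁ + t m₂) · (((1−t)q₁ + t q₂)_# 𝕌)`. -/
noncomputable def scdtInterp (ν₁ ν₂ : Measure ℝ) (t : ℝ) : Measure ℝ :=
  ENNReal.ofReal ((1 - t) * mass ν₁ + t * mass ν₂) •
    Measure.map (fun y => (1 - t) * Fq (nrml ν₁) y + t * Fq (nrml ν₂) y) unif

lemma unif_eq_restrict_Ioo : unif = volume.restrict (Ioo (0:ℝ) 1) :=
  (Measure.restrict_congr_set Ioo_ae_eq_Icc).symm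

instance : IsProbabilityMeasure unif := ⟨by simp [unif]⟩

lemma MonotoneOn.aemeasurable_unif {g : ℝ → ℝ} (hg : MonotoneOn g (Ioo 0 1)) :
    AEMeasurable g unif := by
  rw [unif_eq_restrict_Ioo]
  exact aemeasurable_restrict_of_monotoneOn measurableSet_Ioo hg

lemma Fcdf_eq_cdf (μ : Measure ℝ) [IsProbabilityMeasure μ] (x : ℝ) :
    Fcdf μ x = ProbabilityTheory.cdf μ x :=
  (ProbabilityTheory.cdf_eq_real μ x).symm

lemma Fcdf_map_unif {g : ℝ → ℝ} (hg : MonotoneOn g (Ioo 0 1)) (x : ℝ) :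
    Fcdf (Measure.map g unif) x = (volume (g ⁻¹' Iic x ∩ Ioo 0 1)).toReal := by
  rw [Fcdf, Measure.map_apply_of_aemeasurable hg.aemeasurable_unif measurableSet_Iic,
    unif_eq_restrict_Ioo, Measure.restrict_apply' measurableSet_Ioo]

lemma nonempty_Fcdf_gt (μ : Measure ℝ) [IsProbabilityMeasure μ] {y : ℝ} (hy : y < 1) :
    {x : ℝ | Fcdf μ x > y}.Nonempty := by
  obtain ⟨x, hx⟩ := ((ProbabilityTheory.tendsto_cdf_atTop μ).eventually_const_lt hy).exists
  exact ⟨x, by simpa [Fcdf_eq_cdf] using hx⟩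

lemma bddBelow_Fcdf_gt (μ : Measure ℝ) [IsProbabilityMeasure μ] {y : ℝ} (hy : 0 < y) :
    BddBelow {x : ℝ | Fcdf μ x > y} := by
  obtain ⟨x, hx⟩ := ((ProbabilityTheory.tendsto_cdf_atBot μ).eventually_lt_const hy).exists
  refine ⟨x, fun z hz => ?_⟩
  simp only [mem_ofPred_eq, Fcdf_eq_cdf] at hz
  by_contra! h
  exact absurd (ProbabilityTheory.monotone_cdf μ h.le) (by linarith)

lemma monotoneOn_Fq (μ : Measure ℝ) [IsProbabilityMeasure μ] :
    MonotoneOn (Fq μ) (Ioo 0 1) := fun _ hy _ hz hyz =>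
  csInf_le_csInf (bddBelow_Fcdf_gt μ hy.1) (nonempty_Fcdf_gt μ hz.2)
    fun _ hx => lt_of_le_of_lt hyz hx

lemma le_Fcdf_of_Fq_le (μ : Measure ℝ) [IsProbabilityMeasure μ] {x y : ℝ} (hy : y < 1)
    (h : Fq μ y ≤ x) : y ≤ Fcdf μ x := by
  rw [Fcdf_eq_cdf]
  have hright := (ProbabilityTheory.cdf μ).right_continuous x
  refine ge_of_tendsto (hright.mono_left (nhdsWithin_mono x Ioi_subset_Ici_self)) ?_
  filter_upwards [self_mem_nhdsWithin] with z hz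
  obtain ⟨w, hw, hwz⟩ := exists_lt_of_csInf_lt (nonempty_Fcdf_gt μ hy) (h.trans_lt hz)
  simp only [mem_ofPred_eq, Fcdf_eq_cdf] at hw
  exact hw.le.trans (ProbabilityTheory.monotone_cdf μ hwz.le)

lemma map_Fq_unif (μ : Measure ℝ) [IsProbabilityMeasure μ] :
    Measure.map (Fq μ) unif = μ := by
  have hm := monotoneOn_Fq μ
  have := Measure.isProbabilityMeasure_map hm.aemeasurable_unif
  refine Measure.eq_of_cdf _ _ (StieltjesFunction.ext fun x => ?_)
  have h0 : 0 ≤ Fcdf μ x := ENNReal.toReal_nonneg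
  have h1 : Fcdf μ x ≤ 1 := by
    rw [Fcdf_eq_cdf]; exact ProbabilityTheory.cdf_le_one μ x
  rw [← Fcdf_eq_cdf, ← Fcdf_eq_cdf, Fcdf_map_unif hm]
  have hlo : Ioo 0 (Fcdf μ x) ⊆ Fq μ ⁻¹' Iic x ∩ Ioo 0 1 := fun y hy =>
    ⟨csInf_le (bddBelow_Fcdf_gt μ hy.1) hy.2, hy.1, hy.2.trans_le h1⟩
  have hhi : Fq μ ⁻¹' Iic x ∩ Ioo 0 1 ⊆ Ioc 0 (Fcdf μ x) := fun y hy =>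
    ⟨hy.2.1, le_Fcdf_of_Fq_le μ hy.2.2 hy.1⟩
  have hvol : volume (Fq μ ⁻¹' Iic x ∩ Ioo 0 1) = ENNReal.ofReal (Fcdf μ x) :=
    le_antisymm ((measure_mono hhi).trans (by simp)) (le_trans (by simp) (measure_mono hlo))
  rw [hvol, ENNReal.toReal_ofReal h0]

lemma Fq_map_unif_of_continuousAt {g : ℝ → ℝ} (hg : MonotoneOn g (Ioo 0 1)) {y : ℝ}
    (hy : y ∈ Ioo (0:ℝ) 1) (hc : ContinuousAt g y) : Fq (Measure.map g unif) y = g y := by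
  have hfin : ∀ x, volume (g ⁻¹' Iic x ∩ Ioo (0:ℝ) 1) ≠ ⊤ := fun x =>
    measure_ne_top_of_subset inter_subset_right (by simp)
  have hlower : ∀ x, y < Fcdf (Measure.map g unif) x → g y ≤ x := by
    intro x hx
    by_contra! h
    have hsub : g ⁻¹' Iic x ∩ Ioo (0:ℝ) 1 ⊆ Ioc 0 y := fun u hu =>
      ⟨hu.2.1, by
        by_contra! hyu
        exact absurd (hg hy hu.2 hyu.le) (not_le.2 (lt_of_le_of_lt hu.1 h))⟩
    have hle := ENNReal.toReal_mono (by simp) (measure_mono (μ := volume) hsub)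
    rw [← Fcdf_map_unif hg] at hle
    simp [hy.1.le] at hle
    linarith
  have hupper : ∀ x, g y < x → y < Fcdf (Measure.map g unif) x := by
    intro x hx
    have hev := (hc.eventually_lt_const hx).and (Ioo_mem_nhds hy.1 hy.2)
    obtain ⟨z, ⟨hz, hz01⟩, hyz⟩ := ((hev.filter_mono nhdsWithin_le_nhds).and
      (self_mem_nhdsWithin : Ioi y ∈ nhdsWithin y (Ioi y))).exists
    have hsub : Ioc 0 z ⊆ g ⁻¹' Iic x ∩ Ioo (0:ℝ) 1 := fun u hu =>
      have hu01 : u ∈ Ioo (0:ℝ) 1 := ⟨hu.1, hu.2.trans_lt hz01.2⟩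
      ⟨(hg hu01 hz01 hu.2).trans hz.le, hu01⟩
    have hle := ENNReal.toReal_mono (hfin x) (measure_mono (μ := volume) hsub)
    rw [← Fcdf_map_unif hg] at hle
    simp [hz01.1.le] at hle
    exact lt_of_lt_of_le hyz hle
  exact csInf_eq_of_forall_ge_of_forall_gt_exists_lt
    ⟨g y + 1, hupper _ (by linarith)⟩ hlower
    fun w hw => ⟨(g y + w) / 2, hupper _ (by linarith), by linarith⟩

lemma Fq_map_unif_ae_eq {g : ℝ → ℝ} (hg : MonotoneOn g (Ioo 0 1)) :
    Fq (Measure.map g unif) =ᵐ[unif] g := by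
  suffices ∀ᵐ y ∂volume.restrict (Ioo (0:ℝ) 1), Fq (Measure.map g unif) y = g y by
    rwa [← unif_eq_restrict_Ioo] at this
  rw [ae_restrict_iff' measurableSet_Ioo]
  filter_upwards [hg.countable_not_continuousWithinAt.ae_notMem volume] with y hy hy01
  refine Fq_map_unif_of_continuousAt hg hy01 ?_
  by_contra h
  exact hy ⟨hy01, fun hc => h (hc.continuousAt (Ioo_mem_nhds hy01.1 hy01.2))⟩

lemma isProbabilityMeasure_nrml {ν : Measure ℝ} [IsFiniteMeasure ν] (hν : ν ≠ 0) :
    IsProbabilityMeasure (nrml ν) :=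
  ⟨by simp [nrml, ENNReal.inv_mul_cancel (Measure.measure_univ_ne_zero.2 hν)]⟩

lemma mass_pos {ν : Measure ℝ} [IsFiniteMeasure ν] (hν : ν ≠ 0) : 0 < mass ν :=
  ENNReal.toReal_pos (Measure.measure_univ_ne_zero.2 hν) (measure_ne_top _ _)

lemma ofReal_mass_smul_nrml {ν : Measure ℝ} [IsFiniteMeasure ν] (hν : ν ≠ 0) :
    ENNReal.ofReal (mass ν) • nrml ν = ν := by
  rw [mass, ENNReal.ofReal_toReal (measure_ne_top _ _), nrml, smul_smul,
    ENNReal.mul_inv_cancel (Measure.measure_univ_ne_zero.2 hν) (measure_ne_top _ _), one_smul]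

lemma mass_ofReal_smul {c : ℝ} (hc : 0 ≤ c) (μ : Measure ℝ) [IsProbabilityMeasure μ] :
    mass (ENNReal.ofReal c • μ) = c := by
  simp [mass, hc]

lemma nrml_ofReal_smul {c : ℝ} (hc : 0 < c) (μ : Measure ℝ) [IsProbabilityMeasure μ] :
    nrml (ENNReal.ofReal c • μ) = μ := by
  simp only [nrml, Measure.smul_apply, measure_univ, smul_eq_mul, mul_one, smul_smul]
  rw [ENNReal.inv_mul_cancel (by simpa using hc) ENNReal.ofReal_ne_top, one_smul]

/-- Geodesic property of the SCDT on nonzero finite positive measures supported in a compact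
interval: `ρ_t` joins `ν₁` to `ν₂`, has mass `(1−t)m₁ + t m₂`, and is a constant-speed geodesic
for the SCDT distance. -/
theorem scdt_geodesic (a b : ℝ) (hab : a ≤ b)
    (ν₁ ν₂ : Measure ℝ) [IsFiniteMeasure ν₁] [IsFiniteMeasure ν₂]
    (hν₁ : ν₁ ≠ 0) (hν₂ : ν₂ ≠ 0)
    (h₁ : ν₁ (Icc a b)ᶜ = 0) (h₂ : ν₂ (Icc a b)ᶜ = 0) :
    scdtInterp ν₁ ν₂ 0 = ν₁ ∧ scdtInterp ν₁ ν₂ 1 = ν₂ ∧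
    (∀ t ∈ Icc (0:ℝ) 1,
      mass (scdtInterp ν₁ ν₂ t) = (1 - t) * mass ν₁ + t * mass ν₂) ∧
    ∀ s ∈ Icc (0:ℝ) 1, ∀ t ∈ Icc (0:ℝ) 1,
      dSCDT (scdtInterp ν₁ ν₂ t) (scdtInterp ν₁ ν₂ s) = |t - s| * dSCDT ν₁ ν₂ := by
  have := isProbabilityMeasure_nrml hν₁
  have := isProbabilityMeasure_nrml hν₂
  have hmono : ∀ t ∈ Icc (0:ℝ) 1, MonotoneOn
      (fun y => (1 - t) * Fq (nrml ν₁) y + t * Fq (nrml ν₂) y) (Ioo 0 1) :=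
    fun t ht y hy z hz hyz => add_le_add
      (mul_le_mul_of_nonneg_left (monotoneOn_Fq (nrml ν₁) hy hz hyz) (sub_nonneg.2 ht.2))
      (mul_le_mul_of_nonneg_left (monotoneOn_Fq (nrml ν₂) hy hz hyz) ht.1)
  have hprob : ∀ t ∈ Icc (0:ℝ) 1, IsProbabilityMeasure
      (Measure.map (fun y => (1 - t) * Fq (nrml ν₁) y + t * Fq (nrml ν₂) y) unif) :=
    fun t ht => Measure.isProbabilityMeasure_map (hmono t ht).aemeasurable_unif
  have hpos : ∀ t ∈ Icc (0:ℝ) 1, 0 < (1 - t) * mass ν₁ + t * mass ν₂ := fun t ht =>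
    convex_Ioi (0:ℝ) (mass_pos hν₁) (mass_pos hν₂) (sub_nonneg.2 ht.2) ht.1 (by ring)
  have hmass : ∀ t ∈ Icc (0:ℝ) 1,
      mass (scdtInterp ν₁ ν₂ t) = (1 - t) * mass ν₁ + t * mass ν₂ := fun t ht =>
    have := hprob t ht
    mass_ofReal_smul (hpos t ht).le _
  have hFq : ∀ t ∈ Icc (0:ℝ) 1, Fq (nrml (scdtInterp ν₁ ν₂ t)) =ᵐ[unif]
      fun y => (1 - t) * Fq (nrml ν₁) y + t * Fq (nrml ν₂) y := fun t ht => by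
    have := hprob t ht
    rw [scdtInterp, nrml_ofReal_smul (hpos t ht)]
    exact Fq_map_unif_ae_eq (hmono t ht)
  refine ⟨?_, ?_, hmass, fun s hs t ht => ?_⟩
  · simpa [scdtInterp, map_Fq_unif] using ofReal_mass_smul_nrml hν₁
  · simpa [scdtInterp, map_Fq_unif] using ofReal_mass_smul_nrml hν₂
  · have hint : ∫ y, |Fq (nrml (scdtInterp ν₁ ν₂ t)) y - Fq (nrml (scdtInterp ν₁ ν₂ s)) y| ^ 2
        ∂unif = (t - s) ^ 2 * ∫ y, |Fq (nrml ν₁) y - Fq (nrml ν₂) y| ^ 2 ∂unif := by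
      rw [← integral_const_mul]
      refine integral_congr_ae ?_
      filter_upwards [hFq t ht, hFq s hs] with y hyt hys
      rw [hyt, hys, sq_abs, sq_abs]
      ring
    rw [dSCDT, dSCDT, hint, hmass t ht, hmass s hs, ← Real.sqrt_sq_eq_abs,
      ← Real.sqrt_mul (sq_nonneg _)]
    congr 1
    ring
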